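/- Let (λ_n)_{n≥1} be a nondecreasing sequence of positive reals with ∑_{n=1}^∞ λ_n^{−δ} < ∞ for some δ ∈ (0,1), and let μ₀ be the product probability measure on ℝ^ℕ whose n-th factor is the centered Gaussian measure on ℝ with variance 1/λ_n. For x ∈ ℝ^ℕ write ‖x‖² = ∑_{n=1}^∞ x_n² ∈ [0,∞]. Let γ : (0,∞) → [0,∞) be increasing and let V : ℝ^ℕ → ℝ be measurable with |V(x)| ≤ (1/2)(γ(ε^{−1}) + ε‖x‖²) for every ε > 0 and every x with ‖x‖ < ∞, and assume Z := ∫ e^{V} dμ₀ ∈ (0,∞). Define the probability measure μ := Z^{−1} e^{V} μ₀. Then there exists a constant k > 0 such that for every λ ≥ 1, ∫_{ℝ^ℕ} ( ∫_{ℝ^ℕ} e^{−λ‖x−y‖²} μ(dy) )^{−1} μ(dx) ≤ e^{γ(kλ)} · ∏_{n=1}^∞ (λ_n + kλ)/√(λ_n² − λ₁²/2). -/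

import Mathlib

open MeasureTheory ProbabilityTheory ENNReal

/-- The (possibly infinite) squared `ℓ²`-norm of `x ∈ ℝ^ℕ`. -/
noncomputable def sqNorm (x : ℕ → ℝ) : ℝ≥0∞ :=
  ∑' n : ℕ, ENNReal.ofReal (x n ^ 2)

/-- `e^{-λ t}` for an extended-real `t ≥ 0`, interpreted as `0` when `t = ∞`. -/
noncomputable def gaussKernel (l : ℝ) (t : ℝ≥0∞) : ℝ≥0∞ :=
  if t = ∞ then 0 else ENNReal.ofReal (Real.exp (-l * t.toReal))

open Filter Topology

/-! ### One-dimensional Gaussian integrals -/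

lemma gaussianReal_lintegral_exp_quadratic {a p : ℝ} (q : ℝ) (ha : 0 < a) (hp : 0 < a + p) :
    ∫⁻ y, ENNReal.ofReal (Real.exp (-(p / 2) * y ^ 2 + q * y))
        ∂gaussianReal 0 (1 / a).toNNReal =
      ENNReal.ofReal (√(a / (a + p)) * Real.exp (q ^ 2 / (2 * (a + p)))) := by
  have hv : (1 / a).toNNReal ≠ 0 := by
    simpa using ha
  have hw : (1 / (a + p)).toNNReal ≠ 0 := by
    simpa using hp
  have key : ∀ y : ℝ, gaussianPDF 0 (1 / a).toNNReal y *
      ENNReal.ofReal (Real.exp (-(p / 2) * y ^ 2 + q * y)) =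
      ENNReal.ofReal (√(a / (a + p)) * Real.exp (q ^ 2 / (2 * (a + p)))) *
        gaussianPDF (q / (a + p)) (1 / (a + p)).toNNReal y := by
    intro y
    rw [gaussianPDF, gaussianPDF, ← ENNReal.ofReal_mul (gaussianPDFReal_nonneg _ _ _),
      ← ENNReal.ofReal_mul (by positivity)]
    congr 1
    rw [gaussianPDFReal, gaussianPDFReal, Real.coe_toNNReal _ (by positivity),
      Real.coe_toNNReal _ (by positivity)]
    have h1 : (√(2 * Real.pi * (1 / a)))⁻¹ =
        √(a / (a + p)) * (√(2 * Real.pi * (1 / (a + p))))⁻¹ := by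
      rw [← Real.sqrt_inv, ← Real.sqrt_inv, ← Real.sqrt_mul (by positivity)]
      congr 1
      field_simp
    rw [h1, mul_assoc, ← Real.exp_add]
    have h2 : -(y - 0) ^ 2 / (2 * (1 / a)) + (-(p / 2) * y ^ 2 + q * y) =
        q ^ 2 / (2 * (a + p)) + -(y - q / (a + p)) ^ 2 / (2 * (1 / (a + p))) := by
      have := hp.ne'
      field_simp
      ring
    rw [h2, Real.exp_add]
    ring
  rw [gaussianReal_of_var_ne_zero _ hv,
    lintegral_withDensity_eq_lintegral_mul _ (measurable_gaussianPDF _ _) (by fun_prop)]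
  simp only [Pi.mul_apply, key]
  rw [lintegral_const_mul _ (measurable_gaussianPDF _ _), lintegral_gaussianPDF_eq_one _ hw, mul_one]

lemma gaussianReal_lintegral_sq (v : NNReal) :
    ∫⁻ y, ENNReal.ofReal (y ^ 2) ∂gaussianReal 0 v = v := by
  have h := (memLp_id_gaussianReal (μ := 0) (v := v) 2)
  have h2 := h.ofReal_variance_eq
  rw [variance_id_gaussianReal, evariance] at h2
  simp only [id, integral_id_gaussianReal, sub_zero] at h2
  rw [ENNReal.ofReal_coe_nnreal] at h2
  rw [h2]
  refine lintegral_congr fun y => ?_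
  rw [← ofReal_norm, ← ENNReal.ofReal_pow (norm_nonneg _), Real.norm_eq_abs, sq_abs]

lemma gaussianReal_lintegral_interaction {a e l : ℝ} (t : ℝ) (ha : 0 < a) (he : 0 < e)
    (hl : 0 < l) :
    ∫⁻ y, ENNReal.ofReal (Real.exp (-l * (t - y) ^ 2 - e / 2 * y ^ 2))
        ∂gaussianReal 0 (1 / a).toNNReal =
      ENNReal.ofReal (√(a / (a + (e + 2 * l))) *
        Real.exp (2 * l ^ 2 * t ^ 2 / (a + (e + 2 * l)) - l * t ^ 2)) := by
  have hb : 0 < a + (e + 2 * l) := by positivity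
  have h : ∀ y : ℝ, ENNReal.ofReal (Real.exp (-l * (t - y) ^ 2 - e / 2 * y ^ 2)) =
      ENNReal.ofReal (Real.exp (-l * t ^ 2)) *
        ENNReal.ofReal (Real.exp (-((e + 2 * l) / 2) * y ^ 2 + (2 * l * t) * y)) := by
    intro y
    rw [← ENNReal.ofReal_mul (by positivity), ← Real.exp_add]
    ring_nf
  simp only [h]
  rw [lintegral_const_mul _ (by fun_prop), gaussianReal_lintegral_exp_quadratic _ ha hb,
    ← ENNReal.ofReal_mul (by positivity)]
  congr 1
  rw [mul_left_comm, ← Real.exp_add]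
  congr 2
  field_simp
  ring

lemma gaussianReal_lintegral_inv_interaction {a e l : ℝ} (ha : 0 < a) (he : 0 < e)
    (hl : 0 < l) (hD : 0 < a ^ 2 - e ^ 2 - 4 * l * e) :
    ∫⁻ t, ENNReal.ofReal (Real.exp (e / 2 * t ^ 2)) *
        (∫⁻ y, ENNReal.ofReal (Real.exp (-l * (t - y) ^ 2 - e / 2 * y ^ 2))
          ∂gaussianReal 0 (1 / a).toNNReal)⁻¹ ∂gaussianReal 0 (1 / a).toNNReal =
      ENNReal.ofReal ((a + (e + 2 * l)) / √(a ^ 2 - e ^ 2 - 4 * l * e)) := by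
  simp only [gaussianReal_lintegral_interaction _ ha he hl]
  set b := a + (e + 2 * l) with hbdef
  have hb : 0 < b := by positivity
  set p := 4 * l ^ 2 / b - (e + 2 * l) with hpdef
  have hap : a + p = (a ^ 2 - e ^ 2 - 4 * l * e) / b := by
    rw [hpdef, eq_div_iff hb.ne', add_mul, sub_mul, div_mul_cancel₀ _ hb.ne', hbdef]
    ring
  have hp : 0 < a + p := by rw [hap]; positivity
  have h : ∀ t : ℝ, ENNReal.ofReal (Real.exp (e / 2 * t ^ 2)) *
      (ENNReal.ofReal (√(a / b) * Real.exp (2 * l ^ 2 * t ^ 2 / b - l * t ^ 2)))⁻¹ =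
      ENNReal.ofReal (√(b / a)) * ENNReal.ofReal (Real.exp (-(p / 2) * t ^ 2 + 0 * t)) := by
    intro t
    rw [← ENNReal.ofReal_inv_of_pos (by positivity), ← ENNReal.ofReal_mul (by positivity),
      ← ENNReal.ofReal_mul (by positivity), mul_inv, ← Real.sqrt_inv, inv_div, ← Real.exp_neg,
      mul_left_comm, ← Real.exp_add]
    congr 3
    rw [hpdef]
    field_simp
    ring
  simp only [h]
  rw [lintegral_const_mul _ (by fun_prop), gaussianReal_lintegral_exp_quadratic _ ha hp,
    ← ENNReal.ofReal_mul (by positivity)]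
  congr 1
  rw [← mul_assoc, ← Real.sqrt_mul (by positivity), hap]
  simp only [ne_eq, OfNat.ofNat_ne_zero, not_false_eq_true, zero_pow, zero_div, Real.exp_zero,
    mul_one]
  have : b / a * (a / ((a ^ 2 - e ^ 2 - 4 * l * e) / b)) =
      b ^ 2 / (a ^ 2 - e ^ 2 - 4 * l * e) := by
    have := hD.ne'
    field_simp
  rw [this, Real.sqrt_div (by positivity), Real.sqrt_sq hb.le]

/-! ### Product measures on sequences -/

section Product

variable {ν : ℕ → Measure ℝ} [∀ n, IsProbabilityMeasure (ν n)] {μ₀ : Measure (ℕ → ℝ)}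

lemma lintegral_prod_range_of_map_eq_pi
    (h : ∀ m : ℕ, μ₀.map (fun x (i : Fin m) => x (i : ℕ)) = Measure.pi fun i : Fin m => ν i)
    {f : ℕ → ℝ → ℝ≥0∞} (hf : ∀ n, Measurable (f n)) (m : ℕ) :
    ∫⁻ x, ∏ n ∈ Finset.range m, f n (x n) ∂μ₀ = ∏ n ∈ Finset.range m, ∫⁻ t, f n t ∂ν n := by
  have hmeas : Measurable fun z : Fin m → ℝ => ∏ i : Fin m, f i (z i) :=
    Finset.measurable_fun_prod _ fun i _ => (hf i).comp (measurable_pi_apply i)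
  have hind := iIndepFun_pi (μ := fun i : Fin m => ν i) (X := fun i => f i)
    fun i => (hf i).aemeasurable
  simp only [Finset.prod_range]
  rw [← lintegral_map (μ := μ₀) (g := fun x (i : Fin m) => x (i : ℕ)) hmeas (by fun_prop), h m,
    lintegral_prod_eq_prod_lintegral_of_indepFun Finset.univ _ hind
      fun i => (hf i).comp (measurable_pi_apply i)]
  refine Finset.prod_congr rfl fun i _ => ?_
  exact (measurePreserving_eval (fun i : Fin m => ν i) i).lintegral_comp (hf i)

lemma lintegral_eval_of_map_eq_pi
    (h : ∀ m : ℕ, μ₀.map (fun x (i : Fin m) => x (i : ℕ)) = Measure.pi fun i : Fin m => ν i)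
    {f : ℝ → ℝ≥0∞} (hf : Measurable f) (n : ℕ) :
    ∫⁻ x, f (x n) ∂μ₀ = ∫⁻ t, f t ∂ν n := by
  have hl := (measurePreserving_eval (fun i : Fin (n + 1) => ν i) (Fin.last n)).lintegral_comp hf
  rw [← h (n + 1), lintegral_map (by fun_prop) (by fun_prop)] at hl
  simpa using hl

end Product

/-! ### Square-summable sequences -/

lemma summable_sq_of_sqNorm_lt_top {x : ℕ → ℝ} (hx : sqNorm x < ∞) :
    Summable fun n => x n ^ 2 := by
  have := ENNReal.summable_toReal hx.ne
  simpa [ENNReal.toReal_ofReal, sq_nonneg] using this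

lemma sqNorm_eq_ofReal_tsum {x : ℕ → ℝ} (hx : Summable fun n => x n ^ 2) :
    sqNorm x = ENNReal.ofReal (∑' n, x n ^ 2) :=
  (ENNReal.ofReal_tsum_of_nonneg (fun _ => sq_nonneg _) hx).symm

lemma Summable.sq_sub {x y : ℕ → ℝ} (hx : Summable fun n => x n ^ 2)
    (hy : Summable fun n => y n ^ 2) : Summable fun n => (x n - y n) ^ 2 := by
  refine Summable.of_nonneg_of_le (fun _ => sq_nonneg _) (fun n => ?_)
    ((hx.mul_left 2).add (hy.mul_left 2))
  nlinarith [sq_nonneg (x n + y n)]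

lemma tendsto_prod_ofReal_exp {w : ℕ → ℝ} (hw : Summable w) :
    Tendsto (fun m => ∏ n ∈ Finset.range m, ENNReal.ofReal (Real.exp (w n))) atTop
      (𝓝 (ENNReal.ofReal (Real.exp (∑' n, w n)))) := by
  have h : ∀ m, ∏ n ∈ Finset.range m, ENNReal.ofReal (Real.exp (w n)) =
      ENNReal.ofReal (Real.exp (∑ n ∈ Finset.range m, w n)) := fun m => by
    rw [Real.exp_sum, ENNReal.ofReal_prod_of_nonneg fun _ _ => (Real.exp_pos _).le]
  simp only [h]
  exact ENNReal.tendsto_ofReal ((Real.continuous_exp.tendsto _).comp hw.hasSum.tendsto_sum_nat)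

/-! ### The quadratic model -/

section Model

variable {lam : ℕ → ℝ} {μ₀ : Measure (ℕ → ℝ)}

lemma ae_sqNorm_lt_top (hpos : ∀ n, 0 < lam n) (hinv : Summable fun n => 1 / lam n)
    (hμ₀ : ∀ m : ℕ, μ₀.map (fun x (i : Fin m) => x (i : ℕ)) =
      Measure.pi fun i : Fin m => gaussianReal 0 (1 / lam (i : ℕ)).toNNReal) :
    ∀ᵐ x ∂μ₀, sqNorm x < ∞ := by
  have hm : Measurable sqNorm := by unfold sqNorm; fun_prop
  refine ae_lt_top hm ?_
  unfold sqNorm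
  rw [lintegral_tsum fun n =>
    (by fun_prop : Measurable fun x : ℕ → ℝ => ENNReal.ofReal (x n ^ 2)).aemeasurable]
  have h : ∀ n, ∫⁻ x, ENNReal.ofReal (x n ^ 2) ∂μ₀ = ENNReal.ofReal (1 / lam n) := fun n => by
    rw [lintegral_eval_of_map_eq_pi (ν := fun n => gaussianReal 0 (1 / lam n).toNNReal) hμ₀
      (f := fun t => ENNReal.ofReal (t ^ 2)) (by fun_prop), gaussianReal_lintegral_sq]
    rfl
  simp only [h]
  rw [← ENNReal.ofReal_tsum_of_nonneg (fun n => (one_div_pos.2 (hpos n)).le) hinv]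
  exact ENNReal.ofReal_ne_top

lemma lintegral_inv_quadratic_le [IsProbabilityMeasure μ₀] (hpos : ∀ n, 0 < lam n)
    (hfin : ∀ᵐ x ∂μ₀, sqNorm x < ∞)
    (hμ₀ : ∀ m : ℕ, μ₀.map (fun x (i : Fin m) => x (i : ℕ)) =
      Measure.pi fun i : Fin m => gaussianReal 0 (1 / lam (i : ℕ)).toNNReal)
    {e l : ℝ} (he : 0 < e) (hl : 0 < l) (hD : ∀ n, 0 < lam n ^ 2 - e ^ 2 - 4 * l * e) {B : ℝ}
    (hB : ∀ m, ∏ n ∈ Finset.range m,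
      (lam n + (e + 2 * l)) / √(lam n ^ 2 - e ^ 2 - 4 * l * e) ≤ B) :
    ∫⁻ x, ENNReal.ofReal (Real.exp (e / 2 * (sqNorm x).toReal)) *
        (∫⁻ y, gaussKernel l (sqNorm fun n => x n - y n) *
          ENNReal.ofReal (Real.exp (-(e / 2) * (sqNorm y).toReal)) ∂μ₀)⁻¹ ∂μ₀ ≤
      ENNReal.ofReal B := by
  set f : ℕ → ℝ → ℝ → ℝ≥0∞ := fun _ s t =>
    ENNReal.ofReal (Real.exp (-l * (s - t) ^ 2 - e / 2 * t ^ 2)) with hf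
  set g : ℕ → ℝ → ℝ≥0∞ := fun n s => ∫⁻ t, f n s t ∂gaussianReal 0 (1 / lam n).toNNReal with hg
  have hgm : ∀ n, Measurable (g n) := fun n => by
    simp only [hg, hf, gaussianReal_lintegral_interaction _ (hpos n) he hl]
    fun_prop
  have hg0 : ∀ n s, g n s ≠ 0 := fun n s => by
    simp only [hg, hf, gaussianReal_lintegral_interaction _ (hpos n) he hl]
    have := hpos n
    rw [Ne, ENNReal.ofReal_eq_zero, not_le]
    positivity
  have hgt : ∀ n s, g n s ≠ ∞ := fun n s => by
    simp only [hg, hf, gaussianReal_lintegral_interaction _ (hpos n) he hl]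
    exact ENNReal.ofReal_ne_top
  have hinner : ∀ x, sqNorm x < ∞ → Tendsto (fun m => ∏ n ∈ Finset.range m, g n (x n)) atTop
      (𝓝 (∫⁻ y, gaussKernel l (sqNorm fun n => x n - y n) *
          ENNReal.ofReal (Real.exp (-(e / 2) * (sqNorm y).toReal)) ∂μ₀)) := by
    intro x hx
    have h1 : ∀ m, ∏ n ∈ Finset.range m, g n (x n) =
        ∫⁻ y, ∏ n ∈ Finset.range m, f n (x n) (y n) ∂μ₀ := fun m =>
      (lintegral_prod_range_of_map_eq_pi (ν := fun n => gaussianReal 0 (1 / lam n).toNNReal) hμ₀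
        (f := fun n t => f n (x n) t) (fun n => by simp only [hf]; fun_prop) m).symm
    simp only [h1]
    refine tendsto_lintegral_of_dominated_convergence (fun _ => 1) (fun m => ?_) (fun m => ?_)
      (by simp) ?_
    · simp only [hf]
      fun_prop
    · refine ae_of_all _ fun y => Finset.prod_le_one' fun n _ => ?_
      simp only [hf]
      rw [ENNReal.ofReal_le_one, Real.exp_le_one_iff]
      nlinarith [sq_nonneg (x n - y n), sq_nonneg (y n)]
    · filter_upwards [hfin] with y hy
      have hx2 := summable_sq_of_sqNorm_lt_top hx
      have hy2 := summable_sq_of_sqNorm_lt_top hy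
      have hxy := hx2.sq_sub hy2
      rw [sqNorm_eq_ofReal_tsum hy2, sqNorm_eq_ofReal_tsum hxy, gaussKernel,
        if_neg ENNReal.ofReal_ne_top, ENNReal.toReal_ofReal (tsum_nonneg fun _ => sq_nonneg _),
        ENNReal.toReal_ofReal (tsum_nonneg fun _ => sq_nonneg _),
        ← ENNReal.ofReal_mul (Real.exp_pos _).le, ← Real.exp_add]
      have h2 := tendsto_prod_ofReal_exp ((hxy.mul_left (-l)).add (hy2.mul_left (-(e / 2))))
      rw [(hxy.mul_left (-l)).tsum_add (hy2.mul_left (-(e / 2))), tsum_mul_left,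
        tsum_mul_left] at h2
      refine h2.congr fun m => Finset.prod_congr rfl fun n _ => ?_
      simp only [hf]
      congr 2
      ring
  have houter : ∀ᵐ x ∂μ₀, ENNReal.ofReal (Real.exp (e / 2 * (sqNorm x).toReal)) *
        (∫⁻ y, gaussKernel l (sqNorm fun n => x n - y n) *
          ENNReal.ofReal (Real.exp (-(e / 2) * (sqNorm y).toReal)) ∂μ₀)⁻¹ =
      liminf (fun m => ∏ n ∈ Finset.range m,
        (ENNReal.ofReal (Real.exp (e / 2 * x n ^ 2)) * (g n (x n))⁻¹)) atTop := by
    filter_upwards [hfin] with x hx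
    have hx2 := summable_sq_of_sqNorm_lt_top hx
    refine (Tendsto.liminf_eq ?_).symm
    have h2 := tendsto_prod_ofReal_exp (hx2.mul_left (e / 2))
    rw [tsum_mul_left] at h2
    rw [sqNorm_eq_ofReal_tsum hx2, ENNReal.toReal_ofReal (tsum_nonneg fun _ => sq_nonneg _)]
    have h3 := ENNReal.Tendsto.mul h2 (Or.inl (by simp [Real.exp_pos]))
      (tendsto_inv_iff.2 (hinner x hx)) (Or.inr ENNReal.ofReal_ne_top)
    refine h3.congr fun m => ?_
    rw [Finset.prod_mul_distrib, ENNReal.prod_inv_distrib]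
    exact fun i _ j _ _ => Or.inl (hg0 _ _)
  rw [lintegral_congr_ae houter]
  refine (lintegral_liminf_le fun m => ?_).trans ?_
  · exact Finset.measurable_fun_prod _ fun n _ => Measurable.mul (by fun_prop)
      ((hgm n).comp (measurable_pi_apply n)).inv
  · refine liminf_le_of_frequently_le' (Frequently.of_forall fun m => ?_)
    rw [lintegral_prod_range_of_map_eq_pi (ν := fun n => gaussianReal 0 (1 / lam n).toNNReal) hμ₀
      (f := fun n t => ENNReal.ofReal (Real.exp (e / 2 * t ^ 2)) * (g n t)⁻¹)
      (fun n => Measurable.mul (by fun_prop) (hgm n).inv)]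
    simp only [hg, hf, gaussianReal_lintegral_inv_interaction (hpos _) he hl (hD _)]
    rw [← ENNReal.ofReal_prod_of_nonneg]
    · exact ENNReal.ofReal_le_ofReal (hB m)
    · intro n _
      have := hpos n
      positivity

end Model

/-! ### Convergence of the product -/

section Product

variable {lam : ℕ → ℝ}

lemma summable_one_div_of_summable_rpow (hpos : ∀ n, 0 < lam n) (hmono : Monotone lam) {δ : ℝ}
    (hδ1 : δ ≤ 1) (hsum : Summable fun n => lam n ^ (-δ)) : Summable fun n => 1 / lam n := by
  refine Summable.of_nonneg_of_le (fun n => (one_div_pos.2 (hpos n)).le) (fun n => ?_)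
    (hsum.mul_left (lam 0 ^ (δ - 1)))
  have h : 1 / lam n = lam n ^ (δ - 1) * lam n ^ (-δ) := by
    rw [← Real.rpow_add (hpos n), one_div, ← Real.rpow_neg_one]
    congr 1
    ring
  rw [h]
  exact mul_le_mul_of_nonneg_right
    (Real.rpow_le_rpow_of_nonpos (hpos 0) (hmono n.zero_le) (by linarith))
    (Real.rpow_nonneg (hpos n).le _)

lemma one_le_add_div_sqrt {a c s : ℝ} (ha : 0 < a) (hc : 0 ≤ c) (hs : 0 ≤ s)
    (hac : 0 < a ^ 2 - c) : 1 ≤ (a + s) / √(a ^ 2 - c) := by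
  rw [one_le_div (Real.sqrt_pos.2 hac), Real.sqrt_le_left (by positivity)]
  nlinarith

lemma add_div_sqrt_sub_one_le {a r s : ℝ} (hr : 0 < r) (hra : r ≤ a) (hs : 0 ≤ s) :
    (a + s) / √(a ^ 2 - r ^ 2 / 2) - 1 ≤ (2 * s + r) * (1 / a) := by
  have ha : 0 < a := hr.trans_le hra
  have hpos : 0 < a - r ^ 2 / (2 * a) := by
    rw [sub_pos, div_lt_iff₀ (by positivity)]
    nlinarith
  have hle : a - r ^ 2 / (2 * a) ≤ √(a ^ 2 - r ^ 2 / 2) := by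
    apply Real.le_sqrt_of_sq_le
    have h1 : (a - r ^ 2 / (2 * a)) ^ 2 = a ^ 2 - r ^ 2 + r ^ 2 * (r ^ 2 / (4 * a ^ 2)) := by
      field_simp
      ring
    have h2 : r ^ 2 / (4 * a ^ 2) ≤ 1 / 2 := by
      rw [div_le_iff₀ (by positivity)]
      nlinarith
    rw [h1]
    nlinarith [sq_nonneg r]
  have h3 : (a + s) / √(a ^ 2 - r ^ 2 / 2) ≤ (a + s) / (a - r ^ 2 / (2 * a)) :=
    div_le_div_of_nonneg_left (by positivity) hpos hle
  refine (sub_le_sub_right h3 1).trans ?_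
  rw [sub_le_iff_le_add, div_le_iff₀ hpos]
  have h4 : ((2 * s + r) * (1 / a) + 1) * (a - r ^ 2 / (2 * a)) - (a + s) =
      (2 * s * a ^ 2 + 2 * r * a ^ 2 - 2 * s * r ^ 2 - r ^ 3 - a * r ^ 2) / (2 * a ^ 2) := by
    field_simp
    ring
  have h5 : 0 ≤ 2 * s * a ^ 2 + 2 * r * a ^ 2 - 2 * s * r ^ 2 - r ^ 3 - a * r ^ 2 := by
    have : r ^ 2 ≤ a ^ 2 := by gcongr
    nlinarith [mul_le_mul_of_nonneg_left this hs, mul_le_mul_of_nonneg_left this hr.le,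
      mul_nonneg (mul_nonneg hr.le ha.le) (sub_nonneg.2 hra)]
  have h6 := div_nonneg h5 (by positivity : 0 ≤ 2 * a ^ 2)
  linarith

lemma prod_range_le_tprod_add_div_sqrt (hpos : ∀ n, 0 < lam n) (hmono : Monotone lam)
    (hinv : Summable fun n => 1 / lam n) {s : ℝ} (hs : 0 ≤ s) (m : ℕ) :
    ∏ n ∈ Finset.range m, (lam n + s) / √(lam n ^ 2 - lam 0 ^ 2 / 2) ≤
      ∏' n, (lam n + s) / √(lam n ^ 2 - lam 0 ^ 2 / 2) := by
  have hle : ∀ n, lam 0 ≤ lam n := fun n => hmono n.zero_le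
  have hone : ∀ n, 1 ≤ (lam n + s) / √(lam n ^ 2 - lam 0 ^ 2 / 2) := fun n =>
    one_le_add_div_sqrt (hpos n) (by positivity) hs (by nlinarith [hle n, hpos 0])
  have hsum : Summable fun n => (lam n + s) / √(lam n ^ 2 - lam 0 ^ 2 / 2) - 1 :=
    Summable.of_nonneg_of_le (fun n => sub_nonneg.2 (hone n))
      (fun n => add_div_sqrt_sub_one_le (hpos 0) (hle n) hs) (hinv.mul_left _)
  have hmul := Real.multipliable_one_add_of_summable hsum
  simp only [add_sub_cancel] at hmul
  refine Monotone.ge_of_tendsto (monotone_nat_of_le_succ fun n => ?_)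
    hmul.hasProd.tendsto_prod_nat m
  rw [Finset.prod_range_succ]
  exact le_mul_of_one_le_right (Finset.prod_nonneg fun i _ => zero_le_one.trans (hone i)) (hone n)

end Product

/-- For `μ = Z⁻¹ e^V μ₀` with `μ₀` the product Gaussian measure on `ℝ^ℕ` with
variances `1/λ_n` (nondecreasing, `∑ λ_n^{-δ} < ∞` for some `δ ∈ (0,1)`; here
indexed from `0`, with `lam 0` in the role of `λ₁`) and `|V(x)| ≤
(γ(ε⁻¹) + ε‖x‖²)/2`, there is `k > 0` such that for every `λ ≥ 1`,
`∫ (∫ e^{-λ‖x-y‖²} μ(dy))⁻¹ μ(dx) ≤ e^{γ(kλ)} ∏_n (λ_n + kλ)/√(λ_n² - λ₁²/2)`. -/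
theorem stmt_9 (lam : ℕ → ℝ) (hpos : ∀ n : ℕ, 0 < lam n) (hmono : Monotone lam)
    (δ : ℝ) (hδ0 : 0 < δ) (hδ1 : δ < 1)
    (hsum : Summable fun n : ℕ => lam n ^ (-δ))
    (μ₀ : Measure (ℕ → ℝ)) [IsProbabilityMeasure μ₀]
    (hμ₀ : ∀ m : ℕ, μ₀.map (fun x (i : Fin m) => x (i : ℕ)) =
      Measure.pi fun i : Fin m => gaussianReal 0 (1 / lam (i : ℕ)).toNNReal)
    (γ : ℝ → ℝ) (hγ0 : ∀ s : ℝ, 0 < s → 0 ≤ γ s)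
    (hγmono : ∀ s t : ℝ, 0 < s → s ≤ t → γ s ≤ γ t)
    (V : (ℕ → ℝ) → ℝ) (hV : Measurable V)
    (hVbound : ∀ ε : ℝ, 0 < ε → ∀ x : ℕ → ℝ, sqNorm x < ∞ →
      |V x| ≤ (γ ε⁻¹ + ε * (sqNorm x).toReal) / 2)
    (Z : ℝ≥0∞) (hZ : Z = ∫⁻ x, ENNReal.ofReal (Real.exp (V x)) ∂μ₀)
    (hZ0 : 0 < Z) (hZtop : Z < ∞)
    (μ : Measure (ℕ → ℝ))
    (hμ : μ = Z⁻¹ • μ₀.withDensity fun x => ENNReal.ofReal (Real.exp (V x))) :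
    ∃ k : ℝ, 0 < k ∧ ∀ l : ℝ, 1 ≤ l →
      ∫⁻ x, (∫⁻ y, gaussKernel l (sqNorm fun n => x n - y n) ∂μ)⁻¹ ∂μ ≤
        ENNReal.ofReal (Real.exp (γ (k * l)) *
          ∏' n : ℕ, (lam n + k * l) / Real.sqrt (lam n ^ 2 - lam 0 ^ 2 / 2)) := by
  have hinv := summable_one_div_of_summable_rpow hpos hmono hδ1.le hsum
  have hfin := ae_sqNorm_lt_top hpos hinv hμ₀
  have hr := hpos 0
  set r := lam 0 with hrdef
  obtain ⟨k, hk3, hkr⟩ : ∃ k : ℝ, 3 ≤ k ∧ 10 ≤ k * r ^ 2 := by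
    refine ⟨max 3 (10 / r ^ 2), le_max_left _ _, ?_⟩
    rw [← div_le_iff₀ (by positivity)]
    exact le_max_right _ _
  have hk : 0 < k := by linarith
  refine ⟨k, hk, fun l hl => ?_⟩
  have hl0 : 0 < l := by linarith
  have hkl : 0 < k * l := by positivity
  set e := (k * l)⁻¹ with hedef
  have he : 0 < e := by positivity
  have hekl : e * (k * l) = 1 := inv_mul_cancel₀ hkl.ne'
  have hke : k * e ≤ 1 := by nlinarith [mul_pos hk he]
  have he1 : e ≤ 1 := by nlinarith
  have hle : 4 * l * e = 4 / k := by
    rw [hedef]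
    field_simp
  have hsmall : e ^ 2 + 4 * l * e ≤ r ^ 2 / 2 := by
    have h1 : e ^ 2 ≤ 1 / k := by
      rw [le_div_iff₀ hk]
      nlinarith
    have h2 : 5 / k ≤ r ^ 2 / 2 := by
      rw [div_le_div_iff₀ hk two_pos]
      linarith
    rw [hle]
    have : 1 / k + 4 / k = 5 / k := by ring
    linarith
  have hrle : ∀ n, r ≤ lam n := fun n => hmono n.zero_le
  have hD' : ∀ n, 0 < lam n ^ 2 - r ^ 2 / 2 := fun n => by nlinarith [hrle n]
  have hD : ∀ n, lam n ^ 2 - r ^ 2 / 2 ≤ lam n ^ 2 - e ^ 2 - 4 * l * e := fun n => by linarith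
  have hmodel := lintegral_inv_quadratic_le hpos hfin hμ₀ he hl0
    (fun n => (hD' n).trans_le (hD n))
    (B := ∏' n, (lam n + k * l) / √(lam n ^ 2 - r ^ 2 / 2)) (fun m => by
      refine le_trans (Finset.prod_le_prod (fun n _ => ?_) fun n _ => ?_)
        (prod_range_le_tprod_add_div_sqrt hpos hmono hinv hkl.le m)
      · have := hpos n
        positivity
      · have h1 : e + 2 * l ≤ k * l := by nlinarith
        have := hpos n
        exact div_le_div₀ (by positivity) (by linarith) (Real.sqrt_pos.2 (hD' n))
          (Real.sqrt_le_sqrt (hD n)))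
  have hVm : Measurable fun x => ENNReal.ofReal (Real.exp (V x)) := by fun_prop
  have hμint : ∀ F : (ℕ → ℝ) → ℝ≥0∞,
      ∫⁻ x, F x ∂μ = Z⁻¹ * ∫⁻ x, ENNReal.ofReal (Real.exp (V x)) * F x ∂μ₀ := fun F => by
    rw [hμ, lintegral_smul_measure, lintegral_withDensity_eq_lintegral_mul_non_measurable _ hVm
      (ae_of_all _ fun x => ENNReal.ofReal_lt_top)]
    rfl
  set G := γ (k * l) with hG
  have hVb : ∀ x, sqNorm x < ∞ → |V x| ≤ G / 2 + e / 2 * (sqNorm x).toReal := fun x hx => by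
    have := hVbound e he x hx
    rw [hedef, inv_inv, ← hedef] at this
    linarith
  have hinner : ∀ x : ℕ → ℝ, ENNReal.ofReal (Real.exp (-(G / 2))) *
      ∫⁻ y, gaussKernel l (sqNorm fun n => x n - y n) *
        ENNReal.ofReal (Real.exp (-(e / 2) * (sqNorm y).toReal)) ∂μ₀ ≤
      ∫⁻ y, ENNReal.ofReal (Real.exp (V y)) * gaussKernel l (sqNorm fun n => x n - y n) ∂μ₀ := by
    intro x
    rw [← lintegral_const_mul' _ _ ENNReal.ofReal_ne_top]
    refine lintegral_mono_ae ?_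
    filter_upwards [hfin] with y hy
    rw [mul_left_comm, mul_comm, ← ENNReal.ofReal_mul (Real.exp_pos _).le, ← Real.exp_add]
    gcongr
    linarith [neg_abs_le (V y), hVb y hy]
  calc ∫⁻ x, (∫⁻ y, gaussKernel l (sqNorm fun n => x n - y n) ∂μ)⁻¹ ∂μ
      = ∫⁻ x, ENNReal.ofReal (Real.exp (V x)) * (∫⁻ y, ENNReal.ofReal (Real.exp (V y)) *
          gaussKernel l (sqNorm fun n => x n - y n) ∂μ₀)⁻¹ ∂μ₀ := by
        rw [hμint, ← lintegral_const_mul' _ _ (ENNReal.inv_ne_top.2 hZ0.ne')]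
        refine lintegral_congr fun x => ?_
        rw [hμint, ENNReal.mul_inv (Or.inl (ENNReal.inv_ne_zero.2 hZtop.ne))
          (Or.inl (ENNReal.inv_ne_top.2 hZ0.ne')), inv_inv, mul_left_comm, ← mul_assoc Z⁻¹,
          ENNReal.inv_mul_cancel hZ0.ne' hZtop.ne, one_mul]
    _ ≤ ∫⁻ x, ENNReal.ofReal (Real.exp G) *
          (ENNReal.ofReal (Real.exp (e / 2 * (sqNorm x).toReal)) *
          (∫⁻ y, gaussKernel l (sqNorm fun n => x n - y n) *
            ENNReal.ofReal (Real.exp (-(e / 2) * (sqNorm y).toReal)) ∂μ₀)⁻¹) ∂μ₀ := by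
        refine lintegral_mono_ae ?_
        filter_upwards [hfin] with x hx
        refine (mul_le_mul' (ENNReal.ofReal_le_ofReal (Real.exp_le_exp.2
          ((le_abs_self _).trans (hVb x hx)))) (ENNReal.inv_le_inv.2 (hinner x))).trans_eq ?_
        rw [ENNReal.mul_inv (Or.inl (by simp [Real.exp_pos])) (Or.inl ENNReal.ofReal_ne_top),
          ← ENNReal.ofReal_inv_of_pos (Real.exp_pos _), ← Real.exp_neg, neg_neg, ← mul_assoc,
          ← mul_assoc, ← ENNReal.ofReal_mul (Real.exp_pos _).le,
          ← ENNReal.ofReal_mul (Real.exp_pos _).le, ← Real.exp_add, ← Real.exp_add]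
        ring_nf
    _ ≤ _ := by
        rw [lintegral_const_mul' _ _ ENNReal.ofReal_ne_top, ENNReal.ofReal_mul (Real.exp_pos _).le]
        gcongr
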